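/- There is no finite sequence Δ₀, Δ₁, ..., Δ_{t−1} of nonempty compact convex sets in ℝ², such that the intersection of any two of them is an extreme subset (face) of both, satisfying the cyclic chain Δ₀ ≺ Δ₁ ≺ ⋯ ≺ Δ_{t−1} ≺ Δ₀. -/

import Mathlib

open Set

noncomputable section

/-- A point of the integer lattice `ℤ² ⊆ ℝ²`. -/
def IsLatticePoint (p : ℝ × ℝ) : Prop := ∃ a b : ℤ, p = ((a : ℝ), (b : ℝ))

/-- A triangle: the convex hull of three affinely independent points of `ℝ²`. -/
def IsTriangle (Δ : Set (ℝ × ℝ)) : Prop :=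
  ∃ p q r : ℝ × ℝ, AffineIndependent ℝ ![p, q, r] ∧ Δ = convexHull ℝ {p, q, r}

/-- `F` is a face of the triangle `Δ`: the empty set, a vertex, an edge,
or the whole triangle. -/
def IsFaceOf (F Δ : Set (ℝ × ℝ)) : Prop :=
  ∃ p q r : ℝ × ℝ, AffineIndependent ℝ ![p, q, r] ∧ Δ = convexHull ℝ {p, q, r} ∧
    (F = ∅ ∨ F = {p} ∨ F = {q} ∨ F = {r} ∨
     F = segment ℝ p q ∨ F = segment ℝ q r ∨ F = segment ℝ p r ∨ F = Δ)

/-- The determinant of the two edge vectors of the triangle `pqr` emanating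
from `p`; its absolute value is twice the Euclidean area of the triangle. -/
def triDet (p q r : ℝ × ℝ) : ℝ :=
  (q.1 - p.1) * (r.2 - p.2) - (q.2 - p.2) * (r.1 - p.1)

/-- A unimodular triangle: a lattice triangle of area `1/2`. -/
def IsUnimodularTriangle (Δ : Set (ℝ × ℝ)) : Prop :=
  ∃ p q r : ℝ × ℝ, IsLatticePoint p ∧ IsLatticePoint q ∧ IsLatticePoint r ∧
    AffineIndependent ℝ ![p, q, r] ∧ Δ = convexHull ℝ {p, q, r} ∧
    |triDet p q r| = 1

/-- `T` is a unimodular triangulation of the region `P`. -/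
def IsUnimodularTriangulation (P : Set (ℝ × ℝ)) (T : Set (Set (ℝ × ℝ))) : Prop :=
  T.Finite ∧ (∀ Δ ∈ T, IsUnimodularTriangle Δ ∧ Δ ⊆ P) ∧ ⋃₀ T = P ∧
  ∀ Δ₁ ∈ T, ∀ Δ₂ ∈ T, IsFaceOf (Δ₁ ∩ Δ₂) Δ₁ ∧ IsFaceOf (Δ₁ ∩ Δ₂) Δ₂

/-- The number of unimodular triangulations of the region `P`. -/
def numTriangulations (P : Set (ℝ × ℝ)) : ℕ :=
  Set.ncard {T | IsUnimodularTriangulation P T}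

/-- `f m n` is the number of unimodular triangulations of `[0,m] × [0,n]`. -/
def f (m n : ℕ) : ℕ :=
  numTriangulations (Set.Icc (0, 0) ((m : ℝ), (n : ℝ)))

/-- `Δ₂` lies above `Δ₁` (written `Δ₁ ≺ Δ₂`). -/
def LiesAbove (Δ₁ Δ₂ : Set (ℝ × ℝ)) : Prop :=
  ∃ x y₁ y₂ : ℝ, (x, y₁) ∈ Δ₁ \ Δ₂ ∧ (x, y₂) ∈ Δ₂ \ Δ₁ ∧ y₁ < y₂

/-- If `B` lies above `A` and `A ∩ B` is extreme in `A`, then on every vertical line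
all points of `A` lie weakly below all points of `B`. -/
lemma LiesAbove.le {A B : Set (ℝ × ℝ)} (hA : Convex ℝ A) (hB : Convex ℝ B)
    (hAB : IsExtreme ℝ A (A ∩ B)) (h : LiesAbove A B) {x y y' : ℝ}
    (hy : (x, y) ∈ A) (hy' : (x, y') ∈ B) : y ≤ y' := by
  obtain ⟨x₀, y₁, y₂, h₁, h₂, hlt⟩ := h
  by_contra! hc
  have hd : 0 < (y₂ - y₁) + (y - y') := by linarith
  obtain ⟨a, b, ha, hb, hab, heq⟩ : ∃ a b : ℝ, 0 < a ∧ 0 < b ∧ a + b = 1 ∧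
      a * y₁ + b * y = a * y₂ + b * y' := by
    refine ⟨(y - y') / ((y₂ - y₁) + (y - y')), (y₂ - y₁) / ((y₂ - y₁) + (y - y')),
      div_pos (by linarith) hd, div_pos (by linarith) hd, ?_, ?_⟩
    · field_simp
      ring
    · field_simp
      ring
  have hzA : a • (x₀, y₁) + b • (x, y) ∈ A := hA h₁.1 hy ha.le hb.le hab
  have hzB : a • (x₀, y₁) + b • (x, y) ∈ B := by
    have : a • (x₀, y₂) + b • (x, y') ∈ B := hB h₂.1 hy' ha.le hb.le hab
    simpa [heq] using this
  exact h₁.2 (hAB.left_mem_of_mem_openSegment h₁.1 hy ⟨hzA, hzB⟩ ⟨a, b, ha, hb, hab, rfl⟩).2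

/-- Moving from a point outside an extreme subset towards a point of the ambient convex set,
one stays outside the extreme subset until the endpoint is reached. -/
lemma combo_mem_diff {A B : Set (ℝ × ℝ)} (hA : Convex ℝ A) (hAB : IsExtreme ℝ A (A ∩ B))
    {p v : ℝ × ℝ} (hp : p ∈ A \ B) (hv : v ∈ A) {a b : ℝ} (ha : 0 < a) (hb : 0 ≤ b)
    (hab : a + b = 1) : a • p + b • v ∈ A \ B := by
  have hz : a • p + b • v ∈ A := hA hp.1 hv ha.le hb hab
  refine ⟨hz, fun hzB => ?_⟩
  rcases hb.eq_or_lt with rfl | hb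
  · obtain rfl : a = 1 := by linarith
    exact hp.2 (by simpa using hzB)
  · exact hp.2 (hAB.left_mem_of_mem_openSegment hp.1 hv ⟨hz, hzB⟩ ⟨a, b, ha, hb, hab, rfl⟩).2

/-- Witnesses for `A ≺ B` may be moved horizontally towards a common point of `A` and `B`. -/
lemma exists_witness_of_common_point {A B : Set (ℝ × ℝ)} (hA : Convex ℝ A) (hB : Convex ℝ B)
    (hAB : IsExtreme ℝ A (A ∩ B)) (hBA : IsExtreme ℝ B (B ∩ A)) {x₀ y₁ y₂ : ℝ}
    (h₁ : (x₀, y₁) ∈ A \ B) (h₂ : (x₀, y₂) ∈ B \ A) (hlt : y₁ < y₂) {x c : ℝ}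
    (hvA : (x, c) ∈ A) (hvB : (x, c) ∈ B) {x' : ℝ} (hx₀ : x₀ ≤ x') (hx : x' < x) :
    ∃ z₁ z₂ : ℝ, (x', z₁) ∈ A \ B ∧ (x', z₂) ∈ B \ A ∧ z₁ < z₂ := by
  have hd : 0 < x - x₀ := by linarith
  obtain ⟨a, b, ha, hb, hab, heq⟩ : ∃ a b : ℝ, 0 < a ∧ 0 ≤ b ∧ a + b = 1 ∧
      a * x₀ + b * x = x' := by
    refine ⟨(x - x') / (x - x₀), (x' - x₀) / (x - x₀), div_pos (by linarith) hd,
      div_nonneg (by linarith) hd.le, ?_, ?_⟩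
    · field_simp
      ring
    · field_simp
      ring
  refine ⟨a * y₁ + b * c, a * y₂ + b * c, ?_, ?_, ?_⟩
  · simpa [heq] using combo_mem_diff hA hAB h₁ hvA ha hb hab
  · simpa [heq] using combo_mem_diff hB hBA h₂ hvB ha hb hab
  · have := mul_lt_mul_of_pos_left hlt ha
    linarith

/-- Transitivity of `≺` through a set `A` whose rightmost vertical line meets the two others. -/
lemma LiesAbove.trans_of_rightmost {C A B : Set (ℝ × ℝ)}
    (hC : Convex ℝ C) (hA : Convex ℝ A) (hB : Convex ℝ B)
    (hCA : IsExtreme ℝ C (C ∩ A)) (hAC : IsExtreme ℝ A (A ∩ C))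
    (hAB : IsExtreme ℝ A (A ∩ B)) (hBA : IsExtreme ℝ B (B ∩ A))
    (h₁ : LiesAbove C A) (h₂ : LiesAbove A B) {x u v w : ℝ}
    (hu : (x, u) ∈ C) (hv : (x, v) ∈ A) (hw : (x, w) ∈ B) (hmax : ∀ p ∈ A, p.1 ≤ x) :
    LiesAbove C B := by
  have leCA : ∀ {x y y' : ℝ}, (x, y) ∈ C → (x, y') ∈ A → y ≤ y' := h₁.le hC hA hCA
  have leAB : ∀ {x y y' : ℝ}, (x, y) ∈ A → (x, y') ∈ B → y ≤ y' := h₂.le hA hB hAB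
  by_cases hcommon : (x, v) ∈ C ∧ (x, v) ∈ B
  · obtain ⟨hvC, hvB⟩ := hcommon
    have huniq : ∀ y, (x, y) ∈ A → y = v := fun y hy =>
      le_antisymm (leAB hy hvB) (leCA hvC hy)
    obtain ⟨s, p, q, hp, hq, hpq⟩ := h₁
    obtain ⟨s', q', r, hq', hr, hqr⟩ := h₂
    have hs : s < x := by
      refine lt_of_le_of_ne (hmax _ hq.1) ?_
      rintro rfl
      exact hq.2 (huniq q hq.1 ▸ hvC)
    have hs' : s' < x := by
      refine lt_of_le_of_ne (hmax _ hq'.1) ?_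
      rintro rfl
      exact hq'.2 (huniq q' hq'.1 ▸ hvB)
    obtain ⟨p₁, -, hp₁, -, -⟩ := exists_witness_of_common_point hC hA hCA hAC hp hq hpq
      hvC hv (le_max_left s s') (max_lt hs hs')
    obtain ⟨q₁, r₁, hq₁, hr₁, hqr₁⟩ := exists_witness_of_common_point hA hB hAB hBA hq' hr hqr
      hv hvB (le_max_right s s') (max_lt hs hs')
    refine ⟨max s s', p₁, r₁, ⟨hp₁.1, fun hpB => ?_⟩, ⟨hr₁.1, fun hrC => ?_⟩,
      (leCA hp₁.1 hq₁.1).trans_lt hqr₁⟩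
    · exact hp₁.2 (le_antisymm (leCA hp₁.1 hq₁.1) (leAB hq₁.1 hpB) ▸ hq₁.1)
    · exact absurd (leCA hrC hq₁.1) (not_le.2 hqr₁)
  · have huv := leCA hu hv
    have hvw := leAB hv hw
    have huw : u < w := by
      refine lt_of_le_of_ne (huv.trans hvw) ?_
      rintro rfl
      obtain rfl := le_antisymm huv hvw
      exact hcommon ⟨hu, hw⟩
    refine ⟨x, u, w, ⟨hu, fun huB => ?_⟩, ⟨hw, fun hwC => ?_⟩, huw⟩
    · obtain rfl := le_antisymm huv (leAB hv huB)
      exact hcommon ⟨hu, huB⟩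
    · obtain rfl := le_antisymm (leCA hwC hv) hvw
      exact hcommon ⟨hwC, hw⟩

lemma not_liesAbove_self (A : Set (ℝ × ℝ)) : ¬ LiesAbove A A := by
  rintro ⟨x, y, -, h, -, -⟩
  exact h.2 h.1

/-- A planar convex set meets every vertical line between two of its points. -/
lemma Convex.exists_mk_mem {A : Set (ℝ × ℝ)} (hA : Convex ℝ A) {p q : ℝ × ℝ}
    (hp : p ∈ A) (hq : q ∈ A) {x : ℝ} (hpx : p.1 ≤ x) (hxq : x ≤ q.1) :
    ∃ y, (x, y) ∈ A := by
  have hseg : x ∈ segment ℝ p.1 q.1 := by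
    rw [segment_eq_Icc (hpx.trans hxq)]
    exact ⟨hpx, hxq⟩
  obtain ⟨a, b, ha, hb, hab, rfl⟩ := hseg
  exact ⟨_, hA hp hq ha hb hab⟩

/-- A finite family of compact convex planar sets meeting pairwise in faces has a height
function which is strictly increasing along `≺`. -/
lemma exists_height {ι : Type*} (Δ : ι → Set (ℝ × ℝ))
    (hne : ∀ i, (Δ i).Nonempty) (hcpt : ∀ i, IsCompact (Δ i)) (hconv : ∀ i, Convex ℝ (Δ i))
    (hext : ∀ i j, IsExtreme ℝ (Δ i) (Δ i ∩ Δ j)) (s : Finset ι) :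
    ∃ h : ι → ℝ, ∀ i ∈ s, ∀ j ∈ s, LiesAbove (Δ i) (Δ j) → h i < h j := by
  classical
  choose m hm hmax using fun i => (hcpt i).exists_isMaxOn (hne i) continuous_fst.continuousOn
  have hmax' : ∀ i, ∀ p ∈ Δ i, p.1 ≤ (m i).1 := fun i p hp => hmax i hp
  induction s using Finset.induction_on_min_value (fun i => (m i).1) with
  | empty => exact ⟨0, by simp⟩
  | insert a s ha hmin ih =>
    obtain ⟨h, hh⟩ := ih
    obtain ⟨c, hlo, hhi⟩ := Order.exists_between_finsets
      ((s.filter fun i => LiesAbove (Δ i) (Δ a)).image h)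
      ((s.filter fun i => LiesAbove (Δ a) (Δ i)).image h) (by
        simp only [Finset.mem_image, Finset.mem_filter]
        rintro _ ⟨i, ⟨hi, hia⟩, rfl⟩ _ ⟨j, ⟨hj, haj⟩, rfl⟩
        refine hh i hi j hj ?_
        obtain ⟨u, hu⟩ : ∃ u, ((m a).1, u) ∈ Δ i := by
          obtain ⟨x, y₁, y₂, h₁, h₂, -⟩ := hia
          exact (hconv i).exists_mk_mem (p := (x, y₁)) h₁.1 (hm i) (hmax' a (x, y₂) h₂.1) (hmin i hi)
        obtain ⟨w, hw⟩ : ∃ w, ((m a).1, w) ∈ Δ j := by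
          obtain ⟨x, y₁, y₂, h₁, h₂, -⟩ := haj
          exact (hconv j).exists_mk_mem (p := (x, y₂)) h₂.1 (hm j) (hmax' a (x, y₁) h₁.1) (hmin j hj)
        exact hia.trans_of_rightmost (hconv i) (hconv a) (hconv j) (hext i a) (hext a i)
          (hext a j) (hext j a) haj hu (hm a) hw (hmax' a))
    simp only [Finset.mem_image, Finset.mem_filter, forall_exists_index, and_imp] at hlo hhi
    have hne_a : ∀ i ∈ s, i ≠ a := fun i hi hia => ha (hia ▸ hi)
    refine ⟨Function.update h a c, fun i hi j hj hij => ?_⟩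
    rw [Finset.mem_insert] at hi hj
    rcases hi with rfl | hi <;> rcases hj with rfl | hj
    · exact absurd hij (not_liesAbove_self _)
    · simpa [hne_a j hj] using hhi _ j hj hij rfl
    · simpa [hne_a i hi] using hlo _ i hi hij rfl
    · simpa [hne_a i hi, hne_a j hj] using hh i hi j hj hij

/-- There is no cyclic chain `Δ₀ ≺ Δ₁ ≺ ⋯ ≺ Δ_{t-1} ≺ Δ₀` of nonempty compact
convex sets in `ℝ²` such that the intersection of any two of them is an
extreme subset (face) of both. -/
theorem no_cyclic_chain_convex :
    ¬ ∃ (t : ℕ) (Δ : ZMod t → Set (ℝ × ℝ)), 1 ≤ t ∧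
      (∀ i, (Δ i).Nonempty ∧ IsCompact (Δ i) ∧ Convex ℝ (Δ i)) ∧
      (∀ i j, i ≠ j →
        IsExtreme ℝ (Δ i) (Δ i ∩ Δ j) ∧ IsExtreme ℝ (Δ j) (Δ i ∩ Δ j)) ∧
      (∀ i, LiesAbove (Δ i) (Δ (i + 1))) := by
  rintro ⟨t, Δ, ht, hΔ, hface, hchain⟩
  have : NeZero t := ⟨by omega⟩
  have hext : ∀ i j, IsExtreme ℝ (Δ i) (Δ i ∩ Δ j) := by
    intro i j
    by_cases hij : i = j
    · subst hij
      rw [inter_self]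
    · exact (hface i j hij).1
  obtain ⟨h, hh⟩ := exists_height Δ (fun i => (hΔ i).1) (fun i => (hΔ i).2.1)
    (fun i => (hΔ i).2.2) hext Finset.univ
  obtain ⟨i, hi⟩ := Finite.exists_max h
  exact absurd (hi (i + 1))
    (not_le.2 (hh i (Finset.mem_univ _) (i + 1) (Finset.mem_univ _) (hchain i)))
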